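/- Let μ be a centered log-concave probability measure on ℝ^n. Then for every δ > 0 and every Borel set A ⊂ ℝ^n, μ((1+δ)A) ≤ e^{2nδ} μ(A), where (1+δ)A = {(1+δ)x : x ∈ A}. -/

import Mathlib

open MeasureTheory Metric Filter Set Pointwise

noncomputable section

abbrev Euc (n : ℕ) := EuclideanSpace ℝ (Fin n)

/-- `f` is a log-concave (nonnegative) function on `ℝ^n`. -/
def IsLogConcaveFn {n : ℕ} (f : Euc n → ℝ) : Prop :=
  (∀ x, 0 ≤ f x) ∧
  ∀ x y : Euc n, ∀ τ : ℝ, 0 ≤ τ → τ ≤ 1 →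
    f x ^ τ * f y ^ (1 - τ) ≤ f (τ • x + (1 - τ) • y)

lemma supergrad {n : ℕ} {U : Set (Euc n)} (hU : IsOpen U) {g : Euc n → ℝ}
    (hg : ConcaveOn ℝ U g) (h0 : (0 : Euc n) ∈ U) :
    ∃ l : Euc n →L[ℝ] ℝ, ∀ x ∈ U, g x ≤ g 0 + l x := by
  have hc : ContinuousOn g U := hg.continuousOn hU
  have hS : Convex ℝ {p : Euc n × ℝ | p.1 ∈ U ∧ p.2 < g p.1} := hg.convex_strict_hypograph
  have hO : IsOpen {p : Euc n × ℝ | p.1 ∈ U ∧ p.2 < g p.1} := by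
    have h1 : ContinuousOn (fun p : Euc n × ℝ => g p.1 - p.2) (Prod.fst ⁻¹' U) :=
      (hc.comp continuousOn_fst (fun _ h => h)).sub continuousOn_snd
    have := h1.isOpen_inter_preimage (hU.preimage continuous_fst) (isOpen_Ioi (a := (0:ℝ)))
    convert this using 1
    ext p
    simp
  obtain ⟨L, hL⟩ := geometric_hahn_banach_open_point (x := ((0 : Euc n), g 0)) hS hO (by simp)
  have hdec : ∀ x t, L (x, t) = L (x, 0) + t * L (0, 1) := by
    intro x t
    have : ((x, t) : Euc n × ℝ) = (x, 0) + t • (0, 1) := by ext <;> simp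
    rw [this, map_add, map_smul, smul_eq_mul]
  have hb : 0 < L (0, 1) := by
    have h := hL (0, g 0 - 1) ⟨h0, by simp⟩
    rw [hdec, hdec 0 (g 0)] at h
    linarith
  refine ⟨-((L (0, 1))⁻¹ • (L.comp (ContinuousLinearMap.inl ℝ (Euc n) ℝ))), fun x hx => ?_⟩
  have h1 : ∀ t < g x, t ≤ g 0 - (L (0, 1))⁻¹ * L (x, 0) := by
    intro t ht
    have h := hL (x, t) ⟨hx, ht⟩
    rw [hdec, hdec 0 (g 0)] at h
    have h00 : L ((0 : Euc n), (0:ℝ)) = 0 := by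
      have : ((0 : Euc n), (0:ℝ)) = 0 := rfl
      rw [this, map_zero]
    rw [h00] at h
    have : t = (L (0, 1))⁻¹ * (t * L (0, 1)) := by field_simp
    have h2 : g 0 = (L (0, 1))⁻¹ * (g 0 * L (0, 1)) := by field_simp
    rw [this, h2, ← mul_sub]
    exact mul_le_mul_of_nonneg_left (by linarith) (inv_pos.2 hb).le
  have := le_of_forall_lt_imp_le_of_dense h1
  simpa [sub_eq_add_neg] using this

lemma convex_superlevel {n : ℕ} {f : Euc n → ℝ} (hf : IsLogConcaveFn f) (t : ℝ) :
    Convex ℝ {x | t ≤ f x} := by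
  rw [convex_iff_forall_pos]
  intro x hx y hy a b ha hb hab
  simp only [mem_ofPred_eq] at *
  rcases le_or_gt t 0 with ht | ht
  · exact ht.trans (hf.1 _)
  have h := hf.2 x y a ha.le (by linarith)
  have hb' : 1 - a = b := by linarith
  rw [hb'] at h
  refine le_trans ?_ h
  calc t = t ^ a * t ^ b := by rw [← Real.rpow_add ht, hab, Real.rpow_one]
    _ ≤ _ := by gcongr; exact Real.rpow_nonneg (hf.1 _) _

lemma convex_supp {n : ℕ} {f : Euc n → ℝ} (hf : IsLogConcaveFn f) :
    Convex ℝ {x | 0 < f x} := by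
  rw [convex_iff_forall_pos]
  intro x hx y hy a b ha hb hab
  simp only [mem_ofPred_eq] at *
  have h := hf.2 x y a ha.le (by linarith)
  have hb' : 1 - a = b := by linarith
  rw [hb'] at h
  refine lt_of_lt_of_le ?_ h
  positivity

lemma concave_log {n : ℕ} {f : Euc n → ℝ} (hf : IsLogConcaveFn f) :
    ConcaveOn ℝ {x | 0 < f x} (fun x => Real.log (f x)) := by
  refine ⟨convex_supp hf, ?_⟩
  intro x hx y hy a b ha hb hab
  simp only [mem_ofPred_eq] at *
  have h := hf.2 x y a ha (by linarith)
  have hb' : 1 - a = b := by linarith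
  rw [hb'] at h
  have := Real.log_le_log (by positivity) h
  rwa [Real.log_mul (by positivity) (by positivity), Real.log_rpow hx, Real.log_rpow hy] at this

lemma aemeas {n : ℕ} {f : Euc n → ℝ} (hf : IsLogConcaveFn f) :
    AEMeasurable f (volume : Measure (Euc n)) := by
  apply NullMeasurable.aemeasurable
  have : @Measurable (NullMeasurableSpace (Euc n) volume) ℝ _ _ f := by
    apply measurable_of_Ici
    intro t
    exact (convex_superlevel hf t).nullMeasurableSet volume
  exact this

lemma ae_interior {n : ℕ} {C : Set (Euc n)} (hC : Convex ℝ C) :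
    ∀ᵐ x ∂(volume : Measure (Euc n)), x ∈ C → x ∈ interior C := by
  have h := hC.addHaar_frontier (μ := (volume : Measure (Euc n)))
  have h2 : ∀ᵐ x ∂(volume : Measure (Euc n)), x ∉ frontier C := measure_eq_zero_iff_ae_notMem.1 h
  filter_upwards [h2] with x hx hxC
  by_contra hi
  exact hx ⟨subset_closure hxC, hi⟩

lemma decay {n : ℕ} {f : Euc n → ℝ} (hf : IsLogConcaveFn f) (μ : Measure (Euc n))
    [IsProbabilityMeasure μ]
    (hμ : μ = volume.withDensity (fun x => ENNReal.ofReal (f x))) :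
    ∃ (a : Euc n) (c R : ℝ), 0 < R ∧ 0 < c ∧
      ∀ x, R < ‖x - a‖ → f x ≤ c * Real.exp (-(‖x - a‖ / R)) := by
  obtain ⟨c, hc, hcv⟩ : ∃ c : ℝ, 0 < c ∧ volume {x | c ≤ f x} ≠ 0 := by
    by_contra! hcon
    have h0 : ∀ k : ℕ, ∀ᵐ x ∂(volume : Measure (Euc n)), ¬ (1 / ((k:ℝ) + 1) ≤ f x) :=
      fun k => measure_eq_zero_iff_ae_notMem.1 (hcon (1 / ((k:ℝ) + 1)) (by positivity))
    have h1 : (fun x => ENNReal.ofReal (f x)) =ᵐ[volume] 0 := by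
      filter_upwards [ae_all_iff.2 h0] with x hx
      simp only [Pi.zero_apply, ENNReal.ofReal_eq_zero]
      by_contra! hp
      obtain ⟨k, hk⟩ := exists_nat_one_div_lt hp
      exact hx k hk.le
    have h2 : μ univ = 0 := by
      rw [hμ, withDensity_congr_ae h1]; simp
    simp at h2
  obtain ⟨a, ha⟩ : (interior {x | c ≤ f x}).Nonempty := by
    by_contra hne
    rw [not_nonempty_iff_eq_empty] at hne
    apply hcv
    have := ae_interior (convex_superlevel hf c)
    rw [hne] at this
    exact measure_eq_zero_iff_ae_notMem.2 (by simpa using this)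
  obtain ⟨r, hr, hball⟩ := Metric.isOpen_iff.1 isOpen_interior a ha
  have hball : ball a r ⊆ {x | c ≤ f x} := hball.trans interior_subset
  have hac : c ≤ f a := hball (mem_ball_self hr)
  set d := c * Real.exp (-1) with hd
  have hd0 : 0 < d := by positivity
  have hdc : d ≤ c := by
    rw [hd]; exact mul_le_of_le_one_right hc.le (Real.exp_le_one_iff.2 (by norm_num))
  set η : ENNReal := ENNReal.ofReal d * volume (ball (0 : Euc n) (r / 2)) with hη
  have hη0 : 0 < η := ENNReal.mul_pos (by simpa using hd0)
    (measure_ball_pos _ _ (by positivity)).ne'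
  obtain ⟨K, hK, hKμ⟩ := isTightMeasureSet_iff_exists_isCompact_measure_compl_le.1
    (isTightMeasureSet_singleton (μ := μ)) (η / 2) (ENNReal.half_pos hη0.ne')
  obtain ⟨R, hR⟩ := hK.isBounded.subset_closedBall a
  have hbdd : ∀ y, d ≤ f y → ‖y - a‖ ≤ 2 * R + r := by
    intro y hy
    by_contra! hlt
    have hsub : ball ((1/2 : ℝ) • y + (1/2 : ℝ) • a) (r / 2) ⊆ {x | d ≤ f x} := by
      intro z hz
      have hz' : (2:ℝ) • z - y ∈ ball a r := by
        rw [mem_ball_iff_norm] at hz ⊢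
        have : (2:ℝ) • z - y - a = (2:ℝ) • (z - ((1/2 : ℝ) • y + (1/2 : ℝ) • a)) := by
          module
        rw [this, norm_smul]; simp at hz ⊢; linarith
      have h1 : d ≤ f ((2:ℝ) • z - y) := hdc.trans (hball hz')
      have := convex_superlevel hf d hy h1 (a := 1/2) (b := 1/2) (by norm_num) (by norm_num)
        (by norm_num)
      convert this using 1
      module
    have hsub2 : ball ((1/2 : ℝ) • y + (1/2 : ℝ) • a) (r / 2) ⊆ Kᶜ := by
      intro z hz hzK
      have h1 := hR hzK
      rw [mem_closedBall_iff_norm] at h1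
      rw [mem_ball_iff_norm'] at hz
      have h2 : ‖(1/2 : ℝ) • (y - a)‖ ≤ ‖(1/2 : ℝ) • y + (1/2 : ℝ) • a - z‖ + ‖z - a‖ := by
        refine le_trans (le_of_eq ?_) (norm_add_le _ _)
        congr 1; module
      rw [norm_smul] at h2
      simp at h2 hz
      linarith
    have h3 : η ≤ μ (ball ((1/2 : ℝ) • y + (1/2 : ℝ) • a) (r / 2)) := by
      rw [hμ, withDensity_apply _ measurableSet_ball, hη,
        ← Measure.addHaar_ball_center volume ((1/2 : ℝ) • y + (1/2 : ℝ) • a) (r/2),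
        ← setLIntegral_const]
      refine setLIntegral_mono' measurableSet_ball fun z hz => ?_
      exact ENNReal.ofReal_le_ofReal (hsub hz)
    have h4 : η ≤ η / 2 := h3.trans ((measure_mono hsub2).trans (hKμ μ rfl))
    have hηt : η ≠ ⊤ := ENNReal.mul_ne_top (by simp) measure_ball_lt_top.ne
    exact absurd h4 (not_le.2 (ENNReal.half_lt_self hη0.ne' hηt))
  refine ⟨a, c, |2 * R + r| + 1, by positivity, hc, fun x hx => ?_⟩
  set Q := |2 * R + r| + 1 with hQ
  have hQ0 : 0 < Q := by positivity
  have hxa : 0 < ‖x - a‖ := hQ0.trans hx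
  rcases (hf.1 x).eq_or_lt with h0 | hpos
  · rw [← h0]; positivity
  set τ := Q / ‖x - a‖ with hτ
  have hτ0 : 0 < τ := by positivity
  have hτ1 : τ ≤ 1 := by rw [hτ, div_le_one hxa]; exact hx.le
  have h := hf.2 x a τ hτ0.le hτ1
  have hy : f (τ • x + (1 - τ) • a) < d := by
    by_contra! hge
    have := hbdd _ hge
    have e : τ • x + (1 - τ) • a - a = τ • (x - a) := by module
    rw [e, norm_smul, Real.norm_of_nonneg hτ0.le, hτ, div_mul_cancel₀ _ hxa.ne'] at this
    have := le_abs_self (2 * R + r)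
    linarith
  have h2 : f x ^ τ * c ^ (1 - τ) < c * Real.exp (-1) := by
    refine lt_of_le_of_lt ?_ (h.trans_lt hy)
    have : 0 ≤ 1 - τ := by linarith
    gcongr
  have h3 := Real.log_lt_log (by positivity) h2
  rw [Real.log_mul (by positivity) (by positivity), Real.log_rpow hpos, Real.log_rpow hc,
    Real.log_mul (by positivity) (by positivity), Real.log_exp] at h3
  have h4 : Real.log (f x) ≤ Real.log c - 1 / τ := by
    have : τ * (Real.log (f x) - Real.log c) < -1 := by linarith
    have h5 : Real.log (f x) - Real.log c < -1 / τ := by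
      rw [lt_div_iff₀ hτ0]; linarith
    have : -1 / τ = - (1 / τ) := by ring
    linarith
  have e : 1 / τ = ‖x - a‖ / Q := by rw [hτ, one_div_div]
  rw [e] at h4
  calc f x = Real.exp (Real.log (f x)) := (Real.exp_log hpos).symm
    _ ≤ Real.exp (Real.log c - ‖x - a‖ / Q) := Real.exp_le_exp.2 h4
    _ = _ := by rw [sub_eq_add_neg, Real.exp_add, Real.exp_log hc]

lemma dens_integrable_iff {n : ℕ} {f : Euc n → ℝ} (hf : IsLogConcaveFn f) {μ : Measure (Euc n)}
    (hμ : μ = volume.withDensity (fun x => ENNReal.ofReal (f x)))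
    {F : Type*} [NormedAddCommGroup F] [NormedSpace ℝ F] (g : Euc n → F) :
    Integrable g μ ↔ Integrable (fun x => f x • g x) volume := by
  rw [hμ, integrable_withDensity_iff_integrable_smul₀' (aemeas hf).ennreal_ofReal (by simp)]
  simp_rw [ENNReal.toReal_ofReal (hf.1 _)]

lemma dens_integral {n : ℕ} {f : Euc n → ℝ} (hf : IsLogConcaveFn f) {μ : Measure (Euc n)}
    (hμ : μ = volume.withDensity (fun x => ENNReal.ofReal (f x)))
    {F : Type*} [NormedAddCommGroup F] [NormedSpace ℝ F] (g : Euc n → F) :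
    ∫ x, g x ∂μ = ∫ x, f x • g x := by
  rw [hμ, integral_withDensity_eq_integral_toReal_smul₀ (aemeas hf).ennreal_ofReal (by simp)]
  simp_rw [ENNReal.toReal_ofReal (hf.1 _)]

lemma int_f {n : ℕ} {f : Euc n → ℝ} (hf : IsLogConcaveFn f) {μ : Measure (Euc n)}
    [IsProbabilityMeasure μ]
    (hμ : μ = volume.withDensity (fun x => ENNReal.ofReal (f x))) :
    Integrable f ∧ ∫ x, f x = 1 := by
  have h1 := (dens_integrable_iff hf hμ (fun _ => (1:ℝ))).1 (integrable_const 1)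
  have h2 := dens_integral hf hμ (fun _ => (1:ℝ))
  simp at h1 h2
  exact ⟨h1, h2.symm⟩

lemma exp_bound (n : ℕ) {R s : ℝ} (hR : 0 < R) (hs : 0 ≤ s) :
    (1 + s) * Real.exp (-(s / R)) ≤
      (R ^ (n + 2) * (n + 2).factorial * Real.exp (1 / R)) * (1 + s) ^ (-((n : ℝ) + 1)) := by
  have h := Real.pow_div_factorial_le_exp (x := (1 + s) / R) (by positivity) (n + 2)
  have hp : (1 + s) ^ (-((n : ℝ) + 1)) = ((1 + s) ^ (n + 1))⁻¹ := by
    rw [Real.rpow_neg (by positivity)]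
    congr 1
    exact_mod_cast Real.rpow_natCast (1 + s) (n + 1)
  rw [hp, ← div_eq_mul_inv, le_div_iff₀ (by positivity), Real.exp_neg]
  rw [div_pow, div_div, div_le_iff₀ (by positivity), add_div, Real.exp_add] at h
  have he : 0 < Real.exp (s / R) := Real.exp_pos _
  calc (1 + s) * (Real.exp (s / R))⁻¹ * (1 + s) ^ (n + 1)
      = (1 + s) ^ (n + 2) * (Real.exp (s / R))⁻¹ := by ring
    _ ≤ (Real.exp (1 / R) * Real.exp (s / R) * (R ^ (n + 2) * (n + 2).factorial))
          * (Real.exp (s / R))⁻¹ := by gcongr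
    _ = _ := by field_simp

lemma int_moment {n : ℕ} {f : Euc n → ℝ} (hf : IsLogConcaveFn f) {μ : Measure (Euc n)}
    [IsProbabilityMeasure μ]
    (hμ : μ = volume.withDensity (fun x => ENNReal.ofReal (f x))) :
    Integrable (fun x => f x • x) := by
  obtain ⟨a, c, R, hR, hc, hdec⟩ := decay hf μ hμ
  have hfi := (int_f hf hμ).1
  set K := R ^ (n + 2) * (n + 2).factorial * Real.exp (1 / R) with hK
  have hJ : Integrable (fun x : Euc n => (1 + ‖x - a‖) ^ (-((n : ℝ) + 1))) := by
    have := integrable_one_add_norm (E := Euc n) (μ := volume) (r := (n : ℝ) + 1) (by simp)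
    exact this.comp_sub_right a
  have hB : Integrable (fun x : Euc n => f x * (‖a‖ + R) +
      (c * (1 + ‖a‖) * K) * (1 + ‖x - a‖) ^ (-((n : ℝ) + 1))) :=
    (hfi.mul_const _).add (hJ.const_mul _)
  refine hB.mono' ((aemeas hf).aestronglyMeasurable.smul aestronglyMeasurable_id) ?_
  refine Eventually.of_forall fun x => ?_
  rw [norm_smul, Real.norm_of_nonneg (hf.1 x)]
  have hx : ‖x‖ ≤ ‖x - a‖ + ‖a‖ := by simpa using norm_add_le (x - a) a
  have hfx := hf.1 x
  have hp : 0 ≤ (1 + ‖x - a‖) ^ (-((n : ℝ) + 1)) := by positivity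
  have hK0 : 0 ≤ K := by positivity
  rcases le_or_gt ‖x - a‖ R with h | h
  · have : f x * ‖x‖ ≤ f x * (‖a‖ + R) := by gcongr; linarith
    have h2 : 0 ≤ (c * (1 + ‖a‖) * K) * (1 + ‖x - a‖) ^ (-((n : ℝ) + 1)) := by positivity
    linarith
  · have h1 := hdec x h
    have h2 : ‖x‖ ≤ (1 + ‖a‖) * (1 + ‖x - a‖) := by
      nlinarith [norm_nonneg a, norm_nonneg (x - a), mul_nonneg (norm_nonneg a) (norm_nonneg (x - a))]
    have h3 := exp_bound n hR (norm_nonneg (x - a))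
    have h4 : f x * ‖x‖ ≤ (c * (1 + ‖a‖) * K) * (1 + ‖x - a‖) ^ (-((n : ℝ) + 1)) := by
      calc f x * ‖x‖ ≤ (c * Real.exp (-(‖x - a‖ / R))) * ((1 + ‖a‖) * (1 + ‖x - a‖)) := by gcongr
        _ = c * (1 + ‖a‖) * ((1 + ‖x - a‖) * Real.exp (-(‖x - a‖ / R))) := by ring
        _ ≤ c * (1 + ‖a‖) * (K * (1 + ‖x - a‖) ^ (-((n : ℝ) + 1))) := by gcongr
        _ = _ := by ring
    have : 0 ≤ f x * (‖a‖ + R) := by positivity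
    linarith

lemma int_lin {n : ℕ} {f : Euc n → ℝ} (hf : IsLogConcaveFn f) {μ : Measure (Euc n)}
    [IsProbabilityMeasure μ]
    (hμ : μ = volume.withDensity (fun x => ENNReal.ofReal (f x)))
    (hcent : ∫ x, x ∂μ = 0) (l : Euc n →L[ℝ] ℝ) :
    Integrable (fun x => f x * l x) ∧ ∫ x, f x * l x = 0 := by
  have hi := int_moment hf hμ
  have h0 : ∫ x, f x • x = 0 := by rw [← dens_integral hf hμ]; exact hcent
  have h1 := l.integrable_comp hi
  have h2 := l.integral_comp_comm hi
  rw [h0] at h2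
  simp at h1 h2
  exact ⟨h1, h2⟩

lemma zero_mem_supp {n : ℕ} {f : Euc n → ℝ} (hf : IsLogConcaveFn f) {μ : Measure (Euc n)}
    [IsProbabilityMeasure μ]
    (hμ : μ = volume.withDensity (fun x => ENNReal.ofReal (f x)))
    (hcent : ∫ x, x ∂μ = 0) : (0 : Euc n) ∈ interior {x | 0 < f x} := by
  by_contra hcon
  obtain ⟨l, hl⟩ := geometric_hahn_banach_open_point (convex_supp hf).interior isOpen_interior hcon
  obtain ⟨hi, h0⟩ := int_lin hf hμ hcent l
  have hae := ae_interior (convex_supp hf)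
  have hneg : 0 ≤ᵐ[volume] fun x => -(f x * l x) := by
    filter_upwards [hae] with x hx
    rcases (hf.1 x).eq_or_lt with h | h
    · simp [← h]
    · have := hl x (hx h)
      rw [map_zero] at this
      simp only [Pi.zero_apply]
      nlinarith
  have h00 : ∫ x, -(f x * l x) = 0 := by rw [integral_neg, h0, neg_zero]
  have hz := (integral_eq_zero_iff_of_nonneg_ae hneg hi.neg).1 h00
  have hfz : f =ᵐ[volume] 0 := by
    filter_upwards [hae, hz] with x hx hzx
    rcases (hf.1 x).eq_or_lt with h | h
    · exact h.symm
    · have := hl x (hx h)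
      rw [map_zero] at this
      simp only [Pi.zero_apply] at hzx
      nlinarith
  have := (int_f hf hμ).2
  rw [integral_congr_ae hfz] at this
  simp at this

lemma fradelizi {n : ℕ} {f : Euc n → ℝ} (hf : IsLogConcaveFn f) {μ : Measure (Euc n)}
    [IsProbabilityMeasure μ]
    (hμ : μ = volume.withDensity (fun x => ENNReal.ofReal (f x)))
    (hcent : ∫ x, x ∂μ = 0) (y : Euc n) (hy : 0 < f y) :
    Real.log (f y) - Real.log (f 0) ≤ n := by
  have h0U := zero_mem_supp hf hμ hcent
  have h0 : (0 : Euc n) ∈ {x | 0 < f x} := interior_subset h0U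
  replace h0 : 0 < f 0 := h0
  obtain ⟨l, hl⟩ := supergrad isOpen_interior
    ((concave_log hf).subset interior_subset (convex_supp hf).interior) h0U
  obtain ⟨hli, hl0⟩ := int_lin hf hμ hcent l
  obtain ⟨hfi, hf1⟩ := int_f hf hμ
  set D := Real.log (f y) - Real.log (f 0) with hD
  have key : ∀ ε ∈ Ioo (0:ℝ) 1, D * (1 - ε) ≤ n := by
    intro ε ⟨he0, he1⟩
    have hs : 0 < 1 - ε := by linarith
    have hpt : ∀ᵐ x ∂(volume : Measure (Euc n)),
        Real.exp (ε * D) * (f x - ε * (f x * l x)) ≤ f ((1 - ε) • x + ε • y) := by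
      filter_upwards [ae_interior (convex_supp hf)] with x hx
      rcases (hf.1 x).eq_or_lt with h | h
      · simpa [← h] using hf.1 _
      have h1 := hl x (hx h)
      have h2 := hf.2 x y (1 - ε) hs.le (by linarith)
      rw [sub_sub_cancel] at h2
      refine le_trans ?_ h2
      have e1 : f x ^ (1 - ε) * f y ^ ε =
          f x * Real.exp (ε * (Real.log (f y) - Real.log (f x))) := by
        rw [Real.rpow_def_of_pos h, Real.rpow_def_of_pos hy, ← Real.exp_add]
        nth_rewrite 2 [← Real.exp_log h]
        rw [← Real.exp_add]
        congr 1; ring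
      rw [e1]
      have e2 : ε * D + (- (ε * l x)) ≤ ε * (Real.log (f y) - Real.log (f x)) := by
        rw [hD]; nlinarith
      have e3 : 1 - ε * l x ≤ Real.exp (-(ε * l x)) := by
        have := Real.add_one_le_exp (-(ε * l x)); linarith
      calc Real.exp (ε * D) * (f x - ε * (f x * l x))
          = f x * (Real.exp (ε * D) * (1 - ε * l x)) := by ring
        _ ≤ f x * (Real.exp (ε * D) * Real.exp (-(ε * l x))) := by gcongr
        _ = f x * Real.exp (ε * D + (- (ε * l x))) := by rw [Real.exp_add]
        _ ≤ _ := by gcongr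
    have hI1 : Integrable (fun x => Real.exp (ε * D) * (f x - ε * (f x * l x))) :=
      (hfi.sub (hli.const_mul ε)).const_mul _
    have hI2 : Integrable (fun x => f ((1 - ε) • x + ε • y)) :=
      (hfi.comp_add_right (ε • y)).comp_smul hs.ne'
    have hle := integral_mono_ae hI1 hI2 hpt
    have v1 : ∫ x, Real.exp (ε * D) * (f x - ε * (f x * l x)) = Real.exp (ε * D) := by
      rw [integral_const_mul, integral_sub hfi (hli.const_mul ε), integral_const_mul, hl0, hf1]
      simp
    have v2 : ∫ x, f ((1 - ε) • x + ε • y) = ((1 - ε) ^ n)⁻¹ := by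
      have := Measure.integral_comp_smul (volume : Measure (Euc n))
        (fun z => f (z + ε • y)) (1 - ε)
      rw [this, integral_add_right_eq_self f, hf1, abs_of_pos (by positivity)]
      simp
    rw [v1, v2] at hle
    have hlog := Real.log_le_log (Real.exp_pos _) hle
    rw [Real.log_exp, Real.log_inv, Real.log_pow] at hlog
    have h5 := Real.one_sub_inv_le_log_of_pos hs
    have h6 : ε * D ≤ n * (ε / (1 - ε)) := by
      have : ε / (1 - ε) = (1 - ε)⁻¹ - 1 := by field_simp; ring
      rw [this]
      nlinarith [Nat.cast_nonneg (α := ℝ) n]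
    have h7 : ε * (D * (1 - ε)) ≤ ε * n := by
      calc ε * (D * (1 - ε)) = (ε * D) * (1 - ε) := by ring
        _ ≤ (n * (ε / (1 - ε))) * (1 - ε) := by gcongr
        _ = ε * n := by field_simp
    exact le_of_mul_le_mul_left h7 he0
  have ht : Tendsto (fun ε : ℝ => D * (1 - ε)) (nhdsWithin 0 (Ioi 0)) (nhds D) := by
    have : Continuous (fun ε : ℝ => D * (1 - ε)) := by fun_prop
    have h := (this.tendsto 0).mono_left (nhdsWithin_le_nhds (s := Ioi 0))
    simpa using h
  refine le_of_tendsto ht ?_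
  filter_upwards [Ioo_mem_nhdsGT (zero_lt_one (α := ℝ))] with ε he using key ε he

theorem dilation_inequality {n : ℕ} (f : Euc n → ℝ) (μ : Measure (Euc n))
    [IsProbabilityMeasure μ]
    (hf : IsLogConcaveFn f)
    (hμ : μ = volume.withDensity (fun x => ENNReal.ofReal (f x)))
    (hcent : ∫ x, x ∂μ = 0)
    (δ : ℝ) (hδ : 0 < δ)
    (A : Set (Euc n)) (hA : MeasurableSet A) :
    μ ((1 + δ) • A) ≤ ENNReal.ofReal (Real.exp (2 * n * δ)) * μ A := by
  have hs : 0 < 1 + δ := by linarith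
  obtain ⟨hfi, hf1⟩ := int_f hf hμ
  have hval : ∀ B, MeasurableSet B → μ B = ENNReal.ofReal (∫ x in B, f x) := by
    intro B hB
    rw [ofReal_integral_eq_lintegral_ofReal hfi.integrableOn (Eventually.of_forall hf.1),
      ← withDensity_apply _ hB, hμ]
  have h0 : (0 : Euc n) ∈ {x | 0 < f x} := interior_subset (zero_mem_supp hf hμ hcent)
  replace h0 : 0 < f 0 := h0
  have hpt : ∀ x, f ((1 + δ) • x) ≤ Real.exp (n * δ) * f x := by
    intro x
    rcases (hf.1 ((1 + δ) • x)).eq_or_lt with h | h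
    · rw [← h]; exact mul_nonneg (Real.exp_pos _).le (hf.1 x)
    have hF := fradelizi hf hμ hcent _ h
    have h2 := hf.2 ((1 + δ) • x) 0 ((1 + δ)⁻¹) (by positivity)
      (inv_le_one_of_one_le₀ (by linarith))
    rw [smul_smul, inv_mul_cancel₀ hs.ne', one_smul, smul_zero, add_zero] at h2
    have hx : 0 < f x := lt_of_lt_of_le (by positivity) h2
    have h3 := Real.log_le_log (by positivity) h2
    rw [Real.log_mul (by positivity) (by positivity), Real.log_rpow h, Real.log_rpow h0] at h3
    have e : 1 - (1 + δ)⁻¹ = δ / (1 + δ) := by field_simp; ring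
    have e' : (1 + δ)⁻¹ = 1 - δ / (1 + δ) := by field_simp; ring
    rw [e, e'] at h3
    have hq0 : 0 ≤ δ / (1 + δ) := by positivity
    have hq1 : δ / (1 + δ) ≤ δ := div_le_self hδ.le (by linarith)
    have h4 : Real.log (f ((1 + δ) • x)) ≤ n * δ + Real.log (f x) := by
      have : δ / (1 + δ) * (Real.log (f ((1 + δ) • x)) - Real.log (f 0)) ≤ δ / (1 + δ) * n := by
        gcongr
      have h5 : δ / (1 + δ) * n ≤ δ * n := by gcongr
      nlinarith
    rw [← Real.exp_log h, ← Real.exp_log hx, ← Real.exp_add]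
    simpa [Real.exp_log hx] using Real.exp_le_exp.2 h4
  rw [hval _ (hA.const_smul₀ _), hval _ hA, ← ENNReal.ofReal_mul (Real.exp_pos _).le]
  apply ENNReal.ofReal_le_ofReal
  have hch := Measure.setIntegral_comp_smul_of_pos (volume : Measure (Euc n)) f A hs
  have hle : ∫ x in A, f ((1 + δ) • x) ≤ Real.exp (n * δ) * ∫ x in A, f x := by
    rw [← integral_const_mul]
    exact integral_mono (hfi.comp_smul hs.ne').integrableOn (hfi.const_mul _).integrableOn hpt
  have hAn : 0 ≤ ∫ x in A, f x := integral_nonneg hf.1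
  rw [hch] at hle
  simp only [finrank_euclideanSpace, Fintype.card_fin, smul_eq_mul] at hle
  rw [inv_mul_le_iff₀ (by positivity)] at hle
  have hpow : (1 + δ) ^ n ≤ Real.exp (n * δ) := by
    rw [Real.exp_nat_mul]
    gcongr
    have := Real.add_one_le_exp δ; linarith
  calc _ ≤ _ := hle
    _ ≤ Real.exp (n * δ) * (Real.exp (n * δ) * ∫ x in A, f x) := by gcongr
    _ = _ := by rw [← mul_assoc, ← Real.exp_add]; congr 2; ring
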